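/- arXiv:1608.05969 — 3 statements merged into one kernel-verified Lean document; each statement's English description precedes it below -/
import Mathlib

section
/- Let H be a real Hilbert space, C ⊆ H a nonempty convex subset, T : C → C a pseudo-contraction, (αₙ), (βₙ) sequences in [0,1], x ∈ C, and (xₙ), (yₙ) the Ishikawa iteration starting at x. Then for every p ∈ C and every n ∈ ℕ: ‖xₙ₊₁ − p‖² ≤ ‖xₙ − p‖² + αₙβₙ‖Txₙ − Tyₙ‖² − αₙβₙ(1 − 2βₙ)‖Txₙ − xₙ‖² − αₙ(βₙ − αₙ)‖Tyₙ − xₙ‖² + 2‖p − Tp‖·(σ(xₙ, p) + σ(yₙ, p)), where σ(y, w) := ‖w − Tw‖ + ‖y − Tw‖. -/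
theorem norm_sq_convex_combination {H : Type*} [NormedAddCommGroup H] [InnerProductSpace ℝ H]
    (t : ℝ) (a b c : H) :
    ‖t • a + (1 - t) • b - c‖ ^ 2 =
      t * ‖a - c‖ ^ 2 + (1 - t) * ‖b - c‖ ^ 2 - t * (1 - t) * ‖a - b‖ ^ 2 := by
  have h₁ : t • a + (1 - t) • b - c = t • (a - c) + (1 - t) • (b - c) := by module
  have h₂ : a - b = (a - c) - (b - c) := by abel
  rw [h₁, h₂, norm_add_sq_real, norm_sub_sq_real (a - c), norm_smul, norm_smul, mul_pow, mul_pow,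
    Real.norm_eq_abs, Real.norm_eq_abs, sq_abs, sq_abs, real_inner_smul_left,
    real_inner_smul_right]
  ring

/-- The defining inequality of a pseudo-contraction at `z` and `p`, with `w` and `q` the images
of `z` and `p`, turned into a perturbed demicontractivity estimate. -/
theorem norm_image_sub_sq_le_of_pseudocontraction
    {H : Type*} [NormedAddCommGroup H] [InnerProductSpace ℝ H] {z w p q : H}
    (h : ‖w - q‖ ^ 2 ≤ ‖z - p‖ ^ 2 + ‖(z - w) - (p - q)‖ ^ 2) :
    ‖w - p‖ ^ 2 ≤ ‖z - p‖ ^ 2 + ‖z - w‖ ^ 2 + 2 * ‖p - q‖ * (‖p - q‖ + ‖z - q‖) := by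
  have h₁ : w - q = (z - p) - ((z - w) - (p - q)) := by abel
  have h₂ : w - p = (z - p) - (z - w) := by abel
  rw [h₁, norm_sub_sq_real, inner_sub_right] at h
  rw [h₂, norm_sub_sq_real]
  have h_inner : -(‖z - p‖ * ‖p - q‖) ≤ inner ℝ (z - p) (p - q) :=
    neg_le_of_abs_le (abs_real_inner_le_norm _ _)
  have h_tri : ‖z - p‖ ≤ ‖p - q‖ + ‖z - q‖ := by
    have := norm_sub_le_norm_sub_add_norm_sub z q p
    rw [norm_sub_rev q p] at this
    linarith
  have := mul_le_mul_of_nonneg_right h_tri (norm_nonneg (p - q))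
  linarith


/-- key inequality for the Ishikawa iteration of a pseudo-contraction,
where `σ(y,w) = ‖w − Tw‖ + ‖y − Tw‖`. -/
theorem ishikawa_key_inequality
    {H : Type*} [NormedAddCommGroup H] [InnerProductSpace ℝ H]
    (C : Set H) (hCne : C.Nonempty) (hCconv : Convex ℝ C)
    (T : H → H) (hTmap : ∀ c ∈ C, T c ∈ C)
    (hPC : ∀ c ∈ C, ∀ d ∈ C,
      ‖T c - T d‖ ^ 2 ≤ ‖c - d‖ ^ 2 + ‖(c - T c) - (d - T d)‖ ^ 2)
    (α β : ℕ → ℝ)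
    (hα : ∀ n, α n ∈ Set.Icc (0 : ℝ) 1) (hβmem : ∀ n, β n ∈ Set.Icc (0 : ℝ) 1)
    (x₀ : H) (hx₀ : x₀ ∈ C)
    (x y : ℕ → H) (hx0 : x 0 = x₀)
    (hy : ∀ n, y n = β n • T (x n) + (1 - β n) • x n)
    (hxs : ∀ n, x (n + 1) = α n • T (y n) + (1 - α n) • x n) :
    ∀ p ∈ C, ∀ n : ℕ,
      ‖x (n + 1) - p‖ ^ 2 ≤
        ‖x n - p‖ ^ 2 + α n * β n * ‖T (x n) - T (y n)‖ ^ 2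
          - α n * β n * (1 - 2 * β n) * ‖T (x n) - x n‖ ^ 2
          - α n * (β n - α n) * ‖T (y n) - x n‖ ^ 2
          + 2 * ‖p - T p‖ *
              ((‖p - T p‖ + ‖x n - T p‖) + (‖p - T p‖ + ‖y n - T p‖)) := by
  have hxC : ∀ n, x n ∈ C ∧ y n ∈ C := by
    have hyC : ∀ n, x n ∈ C → y n ∈ C := fun n hn => by
      rw [hy]
      exact hCconv (hTmap _ hn) hn (hβmem n).1 (sub_nonneg.2 (hβmem n).2) (by ring)
    intro n
    induction n with
    | zero => exact ⟨hx0 ▸ hx₀, hyC 0 (hx0 ▸ hx₀)⟩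
    | succ k ih =>
      have hk : x (k + 1) ∈ C := by
        rw [hxs]
        exact hCconv (hTmap _ ih.2) ih.1 (hα k).1 (sub_nonneg.2 (hα k).2) (by ring)
      exact ⟨hk, hyC _ hk⟩
  intro p hp n
  obtain ⟨hxn, hyn⟩ := hxC n
  obtain ⟨ha₀, ha₁⟩ := hα n
  obtain ⟨hb₀, hb₁⟩ := hβmem n
  have hTx := norm_image_sub_sq_le_of_pseudocontraction (hPC _ hxn _ hp)
  have hTy := norm_image_sub_sq_le_of_pseudocontraction (hPC _ hyn _ hp)
  have hx_step := norm_sq_convex_combination (α n) (T (y n)) (x n) p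
  have hy_step := norm_sq_convex_combination (β n) (T (x n)) (x n) p
  have hyT := norm_sq_convex_combination (β n) (T (x n)) (x n) (T (y n))
  rw [← hxs] at hx_step
  rw [← hy] at hy_step hyT
  rw [norm_sub_rev (x n) (T (y n))] at hyT
  rw [norm_sub_rev (x n) (T (x n))] at hTx
  have hab : α n * β n ≤ 1 := mul_le_one₀ ha₁ hb₀ hb₁
  have hσx : 0 ≤ 2 * ‖p - T p‖ * (‖p - T p‖ + ‖x n - T p‖) := by positivity
  have hσy : 0 ≤ 2 * ‖p - T p‖ * (‖p - T p‖ + ‖y n - T p‖) := by positivity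
  have e₁ := mul_le_mul_of_nonneg_left hTx (mul_nonneg ha₀ hb₀)
  have e₂ := mul_le_mul_of_nonneg_left hTy ha₀
  have e₃ := mul_le_mul_of_nonneg_right hab hσx
  have e₄ := mul_le_mul_of_nonneg_right ha₁ hσy
  rw [hyT, hy_step] at e₂
  rw [hx_step]
  linarith
end

section
/- Let H be a real Hilbert space, C ⊆ H a nonempty convex subset, T : C → C an L-Lipschitzian pseudo-contraction (L > 0), (αₙ), (βₙ) sequences in [0,1] with αₙ ≤ βₙ for all n and lim βₙ = 0, β a rate of convergence of (βₙ), K := β(⌈1 + √(2L² + 4)⌉), and θ a rate of divergence of the series ∑ₙ α_{n+K}β_{n+K}. Let (xₙ) be the Ishikawa iteration starting at some x ∈ C. Suppose p ∈ C is a fixed point of T and b ∈ ℕ satisfies ‖x_K − p‖ ≤ b. Then Φ(k) := K + θ(2(b² + 1)(k + 1)²) is an approximate fixed point bound for (xₙ) with respect to T: for every k ∈ ℕ there exists N ≤ K + θ(2(b² + 1)(k + 1)²) with ‖x_N − Tx_N‖ ≤ 1/(k+1). -/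
theorem norm_sq_combination {H : Type*} [NormedAddCommGroup H] [InnerProductSpace ℝ H]
    (t : ℝ) (u v w : H) :
    ‖t • u + (1 - t) • v - w‖ ^ 2 =
      t * ‖u - w‖ ^ 2 + (1 - t) * ‖v - w‖ ^ 2 - t * (1 - t) * ‖v - u‖ ^ 2 := by
  have h₁ : t • u + (1 - t) • v - w = t • (u - w) + (1 - t) • (v - w) := by module
  have h₂ : v - u = (v - w) - (u - w) := by abel
  rw [h₁, h₂, norm_add_sq_real, norm_sub_sq_real (v - w), norm_smul, norm_smul, mul_pow, mul_pow,
    inner_smul_left, inner_smul_right, real_inner_comm (u - w)]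
  simp only [Real.norm_eq_abs, sq_abs, conj_trivial]
  ring

/-- One Ishikawa step of a Lipschitzian pseudo-contraction decreases the squared distance to a
fixed point, up to the factor `1 - 2 * s - L ^ 2 * s ^ 2`. -/
theorem ishikawa_step_norm_sq_le {H : Type*} [NormedAddCommGroup H] [InnerProductSpace ℝ H]
    {T : H → H} {L a s : ℝ} {x y p : H} (ha : 0 ≤ a) (has : a ≤ s) (hs₀ : 0 ≤ s)
    (hy : y = s • T x + (1 - s) • x) (hLip : ‖T x - T y‖ ≤ L * ‖x - y‖)
    (hx : ‖T x - p‖ ^ 2 ≤ ‖x - p‖ ^ 2 + ‖x - T x‖ ^ 2)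
    (hTy : ‖T y - p‖ ^ 2 ≤ ‖y - p‖ ^ 2 + ‖y - T y‖ ^ 2) :
    ‖a • T y + (1 - a) • x - p‖ ^ 2 ≤
      ‖x - p‖ ^ 2 - a * s * (1 - 2 * s - L ^ 2 * s ^ 2) * ‖x - T x‖ ^ 2 := by
  have hxy : ‖x - y‖ = s * ‖x - T x‖ := by
    rw [show x - y = s • (x - T x) by rw [hy]; module, norm_smul, Real.norm_of_nonneg hs₀]
  have hTxy : ‖T x - T y‖ ^ 2 ≤ L ^ 2 * s ^ 2 * ‖x - T x‖ ^ 2 := by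
    calc ‖T x - T y‖ ^ 2 ≤ (L * ‖x - y‖) ^ 2 := by gcongr
      _ = L ^ 2 * s ^ 2 * ‖x - T x‖ ^ 2 := by rw [hxy]; ring
  have hyp := norm_sq_combination s (T x) x p
  have hyTy := norm_sq_combination s (T x) x (T y)
  rw [← hy] at hyp hyTy
  rw [norm_sq_combination a (T y) x p]
  have h₁ := mul_le_mul_of_nonneg_left hx hs₀
  have h₂ := mul_le_mul_of_nonneg_left hTxy hs₀
  have h₃ : ‖T y - p‖ ^ 2 ≤ ‖x - p‖ ^ 2
      - s * (1 - 2 * s - L ^ 2 * s ^ 2) * ‖x - T x‖ ^ 2 + (1 - s) * ‖x - T y‖ ^ 2 := by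
    linarith
  have h₄ := mul_le_mul_of_nonneg_left h₃ ha
  have h₅ : 0 ≤ a * (s - a) * ‖x - T y‖ ^ 2 :=
    mul_nonneg (mul_nonneg ha (sub_nonneg.2 has)) (sq_nonneg _)
  linarith

theorem half_le_one_sub_of_le_inv {L s : ℝ} {m : ℕ} (hs₀ : 0 ≤ s)
    (hm : 1 + Real.sqrt (2 * L ^ 2 + 4) ≤ m) (hs : s ≤ 1 / ((m : ℝ) + 1)) :
    1 / 2 ≤ 1 - 2 * s - L ^ 2 * s ^ 2 := by
  set q := Real.sqrt (2 * L ^ 2 + 4) with hq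
  have hq₀ : 0 ≤ q := Real.sqrt_nonneg _
  have hq₂ : q ^ 2 = 2 * L ^ 2 + 4 := Real.sq_sqrt (by positivity)
  have hsq : s * (2 + q) ≤ 1 := by
    rw [le_div_iff₀ (by positivity)] at hs
    nlinarith
  have hqs : 0 ≤ q * s := mul_nonneg hq₀ hs₀
  have h₁ : (q * s) ^ 2 ≤ (1 - 2 * s) ^ 2 := by
    gcongr
    linarith
  have h₂ : (q * s) ^ 2 = 2 * (L ^ 2 * s ^ 2) + 4 * s ^ 2 := by rw [mul_pow, hq₂]; ring
  linarith


/-- `Φ(k) := K + θ(2(b² + 1)(k + 1)²)` is an approximate fixed point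
bound for `(xₙ)` with respect to `T`. -/
theorem ishikawa_approx_fixed_point_bound
    {H : Type*} [NormedAddCommGroup H] [InnerProductSpace ℝ H]
    (C : Set H) (hCne : C.Nonempty) (hCconv : Convex ℝ C)
    (T : H → H) (hTmap : ∀ c ∈ C, T c ∈ C)
    (L : ℝ) (hL : 0 < L)
    (hLip : ∀ c ∈ C, ∀ d ∈ C, ‖T c - T d‖ ≤ L * ‖c - d‖)
    (hPC : ∀ c ∈ C, ∀ d ∈ C,
      ‖T c - T d‖ ^ 2 ≤ ‖c - d‖ ^ 2 + ‖(c - T c) - (d - T d)‖ ^ 2)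
    (α β : ℕ → ℝ)
    (hα : ∀ n, α n ∈ Set.Icc (0 : ℝ) 1) (hβmem : ∀ n, β n ∈ Set.Icc (0 : ℝ) 1)
    (hA3 : ∀ n, α n ≤ β n)
    (hβ0 : Filter.Tendsto β Filter.atTop (nhds 0))
    (ρ : ℕ → ℕ) (hρ : ∀ k : ℕ, ∀ n : ℕ, ρ k ≤ n → β n ≤ 1 / ((k : ℝ) + 1))
    (K : ℕ) (hK : K = ρ ⌈1 + Real.sqrt (2 * L ^ 2 + 4)⌉₊)
    (θ : ℕ → ℕ)
    (hθ : ∀ n : ℕ, (n : ℝ) ≤ ∑ i ∈ Finset.range (θ n + 1), α (i + K) * β (i + K))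
    (x₀ : H) (hx₀ : x₀ ∈ C)
    (x y : ℕ → H) (hx0 : x 0 = x₀)
    (hy : ∀ n, y n = β n • T (x n) + (1 - β n) • x n)
    (hxs : ∀ n, x (n + 1) = α n • T (y n) + (1 - α n) • x n)
    (p : H) (hp : p ∈ C) (hfix : T p = p)
    (b : ℕ) (hb : ‖x K - p‖ ≤ (b : ℝ)) :
    ∀ k : ℕ, ∃ N : ℕ,
      N ≤ K + θ (2 * (b ^ 2 + 1) * (k + 1) ^ 2) ∧
      ‖x N - T (x N)‖ ≤ 1 / ((k : ℝ) + 1) := by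
  have hxC : ∀ n, x n ∈ C := by
    intro n
    induction n with
    | zero => rwa [hx0]
    | succ n ih =>
      have hyC : y n ∈ C := by
        rw [hy]
        exact hCconv (hTmap _ ih) ih (hβmem n).1 (sub_nonneg.2 (hβmem n).2) (by ring)
      rw [hxs]
      exact hCconv (hTmap _ hyC) ih (hα n).1 (sub_nonneg.2 (hα n).2) (by ring)
  have hyC : ∀ n, y n ∈ C := by
    intro n
    rw [hy]
    exact hCconv (hTmap _ (hxC n)) (hxC n) (hβmem n).1 (sub_nonneg.2 (hβmem n).2) (by ring)
  have hPCp : ∀ c ∈ C, ‖T c - p‖ ^ 2 ≤ ‖c - p‖ ^ 2 + ‖c - T c‖ ^ 2 := by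
    intro c hc
    simpa [hfix] using hPC c hc p hp
  have hαβ : ∀ n, 0 ≤ α n * β n := fun n => mul_nonneg (hα n).1 (hβmem n).1
  have hstep : ∀ n, K ≤ n → α n * β n * ‖x n - T (x n)‖ ^ 2 ≤
      2 * (‖x n - p‖ ^ 2 - ‖x (n + 1) - p‖ ^ 2) := by
    intro n hn
    have h₁ := ishikawa_step_norm_sq_le (hα n).1 (hA3 n) (hβmem n).1 (hy n)
      (hLip _ (hxC n) _ (hyC n)) (hPCp _ (hxC n)) (hPCp _ (hyC n))
    rw [← hxs] at h₁
    have h₂ := half_le_one_sub_of_le_inv (hβmem n).1 (Nat.le_ceil _) (hρ _ n (hK ▸ hn))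
    have h₃ := mul_le_mul_of_nonneg_left h₂
      (mul_nonneg (hαβ n) (sq_nonneg ‖x n - T (x n)‖))
    linarith
  have hsum : ∀ m, ∑ i ∈ Finset.range m, α (i + K) * β (i + K) * ‖x (i + K) - T (x (i + K))‖ ^ 2 ≤
      2 * (‖x K - p‖ ^ 2 - ‖x (m + K) - p‖ ^ 2) := by
    intro m
    induction m with
    | zero => simp
    | succ m ih =>
      have h := hstep (m + K) (Nat.le_add_left _ _)
      rw [Finset.sum_range_succ, Nat.add_right_comm m 1 K]
      linarith
  intro k
  by_contra! hcon
  set M := 2 * (b ^ 2 + 1) * (k + 1) ^ 2 with hM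
  have hlower : (∑ i ∈ Finset.range (θ M + 1), α (i + K) * β (i + K)) * (1 / ((k : ℝ) + 1)) ^ 2 ≤
      ∑ i ∈ Finset.range (θ M + 1), α (i + K) * β (i + K) * ‖x (i + K) - T (x (i + K))‖ ^ 2 := by
    rw [Finset.sum_mul]
    refine Finset.sum_le_sum fun i hi => mul_le_mul_of_nonneg_left ?_ (hαβ _)
    have hi' := Finset.mem_range.1 hi
    have h := (hcon (i + K) (by omega)).le
    gcongr
  have hMk : (M : ℝ) * (1 / ((k : ℝ) + 1)) ^ 2 = 2 * ((b : ℝ) ^ 2 + 1) := by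
    rw [hM]
    push_cast
    field_simp
  have hθM := mul_le_mul_of_nonneg_right (hθ M) (sq_nonneg (1 / ((k : ℝ) + 1)))
  have hb₂ : ‖x K - p‖ ^ 2 ≤ (b : ℝ) ^ 2 := by gcongr
  have hupper := hsum (θ M + 1)
  have hnonneg := sq_nonneg ‖x (θ M + 1 + K) - p‖
  linarith
end

section
/- Let H be a real Hilbert space, C ⊆ H a nonempty totally bounded convex subset with modulus of total boundedness γ and diameter at most b ∈ ℕ, T : C → C an L-Lipschitzian pseudo-contraction (L > 0) with Fix(T) ≠ ∅, (αₙ), (βₙ) sequences in [0,1] with αₙ ≤ βₙ for all n and lim βₙ = 0, β a rate of convergence of (βₙ), K := β(⌈1 + √(2L² + 4)⌉), and θ a rate of divergence of the series ∑ₙ α_{n+K}β_{n+K}. Let (xₙ) be the Ishikawa iteration starting at some x ∈ C. For f : ℕ → ℕ define f^M(n) := max_{0 ≤ i ≤ n} f(i). Fix k ∈ ℕ and g : ℕ → ℕ, and set h(n) := g(K + n), k₀ := ⌈(⌈L⌉(4k + 4) − 1)/2⌉, P₀ := γ(⌈√(8k₀² + 16k₀ + 9)⌉), and define Ω₀ :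 ℕ → ℕ recursively by Ω₀(0) := 0 and Ω₀(n+1) := θ^M(2(b² + 1)·(max{2k + 1, 8b(8k₀² + 16k₀ + 10)·h^M(Ω₀(n))} + 1)²). Then there exists N ≤ K + Ω₀(P₀) such that for all i, j ∈ [N, N + g(N)], both ‖xᵢ − xⱼ‖ ≤ 1/(k+1) and ‖xᵢ − Txᵢ‖ ≤ 1/(k+1). -/
/-- `f^M(n) := max_{0 ≤ i ≤ n} f(i)`. -/
def maxUpTo (f : ℕ → ℕ) (n : ℕ) : ℕ := (Finset.range (n + 1)).sup f

theorem maxUpTo_mono (f : ℕ → ℕ) : Monotone (maxUpTo f) := fun _ _ h =>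
  Finset.sup_mono (Finset.range_mono (Nat.succ_le_succ h))

theorem le_maxUpTo (f : ℕ → ℕ) {i n : ℕ} (h : i ≤ n) : f i ≤ maxUpTo f n :=
  Finset.le_sup (Finset.mem_range.2 (Nat.lt_succ_of_le h))

section IshikawaStep

variable {H : Type*} [NormedAddCommGroup H] [InnerProductSpace ℝ H]

theorem norm_sq_convexCombination_sub (t : ℝ) (u v w : H) :
    ‖t • u + (1 - t) • v - w‖ ^ 2 =
      t * ‖u - w‖ ^ 2 + (1 - t) * ‖v - w‖ ^ 2 - t * (1 - t) * ‖u - v‖ ^ 2 := by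
  have h1 : t • u + (1 - t) • v - w = t • (u - w) + (1 - t) • (v - w) := by module
  have h2 : u - v = (u - w) - (v - w) := by abel
  rw [h1, h2, norm_add_sq_real, norm_sub_sq_real (u - w), norm_smul, norm_smul,
    real_inner_smul_left, real_inner_smul_right, mul_pow, mul_pow, Real.norm_eq_abs,
    Real.norm_eq_abs, sq_abs, sq_abs]
  ring

/-- The pseudo-contraction inequality between a point and an approximate fixed point. -/
theorem norm_sq_map_sub_le_of_pseudoContraction {c p Tc Tp : H} {b : ℝ} (hb : ‖c - p‖ ≤ b)
    (h : ‖Tc - Tp‖ ^ 2 ≤ ‖c - p‖ ^ 2 + ‖(c - Tc) - (p - Tp)‖ ^ 2) :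
    ‖Tc - p‖ ^ 2 ≤ ‖c - p‖ ^ 2 + ‖c - Tc‖ ^ 2 + 2 * b * ‖p - Tp‖ := by
  have h1 : Tc - Tp = (Tc - p) + (p - Tp) := by abel
  have h2 : c - p = (Tc - p) + (c - Tc) := by abel
  have h3 : -inner ℝ (c - p) (p - Tp) ≤ b * ‖p - Tp‖ :=
    ((neg_le_abs _).trans (abs_real_inner_le_norm _ _)).trans
      (mul_le_mul_of_nonneg_right hb (norm_nonneg _))
  have h4 : inner ℝ (c - p) (p - Tp) =
      inner ℝ (Tc - p) (p - Tp) + inner ℝ (c - Tc) (p - Tp) := by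
    rw [← inner_add_left, ← h2]
  rw [h1, norm_add_sq_real, norm_sub_sq_real (c - Tc)] at h
  linarith

theorem ishikawa_step_norm_sq_le_s19 {C : Set H} {T : H → H} {L b a t : ℝ} {x y p : H}
    (hb : ∀ c ∈ C, ∀ d ∈ C, ‖c - d‖ ≤ b)
    (hLip : ∀ c ∈ C, ∀ d ∈ C, ‖T c - T d‖ ≤ L * ‖c - d‖)
    (hPC : ∀ c ∈ C, ∀ d ∈ C,
      ‖T c - T d‖ ^ 2 ≤ ‖c - d‖ ^ 2 + ‖(c - T c) - (d - T d)‖ ^ 2)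
    (ha : 0 ≤ a) (hat : a ≤ t) (ht : t ≤ 1)
    (hx : x ∈ C) (hy : y ∈ C) (hp : p ∈ C) (hyx : y = t • T x + (1 - t) • x) :
    ‖a • T y + (1 - a) • x - p‖ ^ 2 ≤ ‖x - p‖ ^ 2 + 4 * b * ‖p - T p‖ -
      a * t * (1 - 2 * t - L ^ 2 * t ^ 2) * ‖x - T x‖ ^ 2 := by
  have hb0 : 0 ≤ b := (norm_nonneg _).trans (hb x hx x hx)
  have hx1 := norm_sq_map_sub_le_of_pseudoContraction (hb x hx p hp) (hPC x hx p hp)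
  have hy1 := norm_sq_map_sub_le_of_pseudoContraction (hb y hy p hp) (hPC y hy p hp)
  have hyp := norm_sq_convexCombination_sub t (T x) x p
  have hyTy := norm_sq_convexCombination_sub t (T x) x (T y)
  rw [← hyx, norm_sub_rev (T x) x] at hyp hyTy
  have hxy : x - y = t • (x - T x) := by rw [hyx]; module
  have hTxy : ‖T x - T y‖ ^ 2 ≤ L ^ 2 * t ^ 2 * ‖x - T x‖ ^ 2 := by
    have h := hLip x hx y hy
    rw [hxy, norm_smul, Real.norm_eq_abs, abs_of_nonneg (ha.trans hat)] at h
    calc ‖T x - T y‖ ^ 2 ≤ (L * (t * ‖x - T x‖)) ^ 2 := by gcongr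
      _ = _ := by ring
  rw [norm_sq_convexCombination_sub, norm_sub_rev (T y) x]
  have ht0 : 0 ≤ t := ha.trans hat
  have e0 : 0 ≤ b * ‖p - T p‖ := mul_nonneg hb0 (norm_nonneg _)
  have hTyp : ‖T y - p‖ ^ 2 ≤ ‖x - p‖ ^ 2 + 4 * (b * ‖p - T p‖) + (1 - t) * ‖x - T y‖ ^ 2 -
      t * (1 - 2 * t - L ^ 2 * t ^ 2) * ‖x - T x‖ ^ 2 := by
    have h1 := mul_le_mul_of_nonneg_left hx1 ht0
    have h2 := mul_le_mul_of_nonneg_left hTxy ht0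
    have h3 := mul_le_mul_of_nonneg_right ht e0
    linarith
  have h1 := mul_le_mul_of_nonneg_left hTyp ha
  have h2 : 0 ≤ a * (t - a) * ‖x - T y‖ ^ 2 :=
    mul_nonneg (mul_nonneg ha (sub_nonneg.2 hat)) (sq_nonneg _)
  have h3 := mul_le_mul_of_nonneg_right (hat.trans ht) e0
  linarith

end IshikawaStep

theorem half_le_one_sub_of_le_inv_s19 {L t : ℝ} (ht0 : 0 ≤ t)
    (ht : t ≤ 1 / (2 + √(2 * L ^ 2 + 4))) : 1 / 2 ≤ 1 - 2 * t - L ^ 2 * t ^ 2 := by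
  set s := √(2 * L ^ 2 + 4) with hs
  have hs2 : s ^ 2 = 2 * L ^ 2 + 4 := Real.sq_sqrt (by positivity)
  have hs0 : 0 ≤ s := Real.sqrt_nonneg _
  have h1 : t * (2 + s) ≤ 1 := (le_div_iff₀ (by positivity)).1 ht
  have h2 : (t * s) ^ 2 ≤ (1 - 2 * t) ^ 2 :=
    pow_le_pow_left₀ (mul_nonneg ht0 hs0) (by linarith) 2
  rw [mul_pow, hs2] at h2
  linarith

theorem exists_le_inv_of_weighted_sum_le {w d : ℕ → ℝ} {θ : ℕ → ℕ} {b r : ℕ}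
    (hw : ∀ n, 0 ≤ w n)
    (hθ : ∀ n : ℕ, (n : ℝ) ≤ ∑ i ∈ Finset.range (θ n + 1), w i)
    (hsum : ∀ n, ∑ i ∈ Finset.range n, w i * d i ^ 2 ≤ 2 * (b : ℝ) ^ 2) :
    ∃ n ≤ θ (2 * (b ^ 2 + 1) * (r + 1) ^ 2), d n ≤ 1 / ((r : ℝ) + 1) := by
  by_contra! hcon
  set M := 2 * (b ^ 2 + 1) * (r + 1) ^ 2 with hM
  have hr : (0 : ℝ) < (r : ℝ) + 1 := by positivity
  have h1 : (∑ i ∈ Finset.range (θ M + 1), w i) * (1 / ((r : ℝ) + 1)) ^ 2 ≤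
      ∑ i ∈ Finset.range (θ M + 1), w i * d i ^ 2 := by
    rw [Finset.sum_mul]
    refine Finset.sum_le_sum fun i hi => mul_le_mul_of_nonneg_left ?_ (hw i)
    exact pow_le_pow_left₀ (by positivity)
      (hcon i (Nat.lt_succ_iff.1 (Finset.mem_range.1 hi))).le 2
  have h2 : (M : ℝ) * (1 / ((r : ℝ) + 1)) ^ 2 ≤ 2 * (b : ℝ) ^ 2 :=
    (mul_le_mul_of_nonneg_right (hθ M) (by positivity)).trans (h1.trans (hsum _))
  have h3 : (M : ℝ) * (1 / ((r : ℝ) + 1)) ^ 2 = 2 * ((b : ℝ) ^ 2 + 1) := by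
    rw [hM]; push_cast; field_simp
  linarith

/-- effective finitization of Ishikawa's theorem: a rate of metastability
together with approximate fixed points on the metastable interval. -/
theorem ishikawa_rate_of_metastability_with_fixed_points
    {H : Type*} [NormedAddCommGroup H] [InnerProductSpace ℝ H]
    (C : Set H) (hCne : C.Nonempty) (hCconv : Convex ℝ C)
    (γ : ℕ → ℕ)
    (hγ : ∀ k : ℕ, ∀ u : ℕ → H, (∀ n, u n ∈ C) →
      ∃ i j : ℕ, i < j ∧ j ≤ γ k ∧ ‖u i - u j‖ ≤ 1 / ((k : ℝ) + 1))
    (b : ℕ) (hb : ∀ c ∈ C, ∀ d ∈ C, ‖c - d‖ ≤ (b : ℝ))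
    (T : H → H) (hTmap : ∀ c ∈ C, T c ∈ C)
    (L : ℝ) (hL : 0 < L)
    (hLip : ∀ c ∈ C, ∀ d ∈ C, ‖T c - T d‖ ≤ L * ‖c - d‖)
    (hPC : ∀ c ∈ C, ∀ d ∈ C,
      ‖T c - T d‖ ^ 2 ≤ ‖c - d‖ ^ 2 + ‖(c - T c) - (d - T d)‖ ^ 2)
    (hFix : ∃ q ∈ C, T q = q)
    (α β : ℕ → ℝ)
    (hα : ∀ n, α n ∈ Set.Icc (0 : ℝ) 1) (hβmem : ∀ n, β n ∈ Set.Icc (0 : ℝ) 1)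
    (hA3 : ∀ n, α n ≤ β n)
    (hβ0 : Filter.Tendsto β Filter.atTop (nhds 0))
    (ρ : ℕ → ℕ) (hρ : ∀ k : ℕ, ∀ n : ℕ, ρ k ≤ n → β n ≤ 1 / ((k : ℝ) + 1))
    (K : ℕ) (hK : K = ρ ⌈1 + Real.sqrt (2 * L ^ 2 + 4)⌉₊)
    (θ : ℕ → ℕ)
    (hθ : ∀ n : ℕ, (n : ℝ) ≤ ∑ i ∈ Finset.range (θ n + 1), α (i + K) * β (i + K))
    (x₀ : H) (hx₀ : x₀ ∈ C)
    (x y : ℕ → H) (hx0 : x 0 = x₀)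
    (hy : ∀ n, y n = β n • T (x n) + (1 - β n) • x n)
    (hxs : ∀ n, x (n + 1) = α n • T (y n) + (1 - α n) • x n)
    (k : ℕ) (g : ℕ → ℕ)
    (k₀ : ℕ) (hk₀ : k₀ = ⌈(((⌈L⌉₊ : ℝ) * (4 * k + 4) - 1) / 2)⌉₊)
    (P₀ : ℕ) (hP₀ : P₀ = γ ⌈Real.sqrt (8 * (k₀ : ℝ) ^ 2 + 16 * k₀ + 9)⌉₊)
    (W₀ : ℕ → ℕ) (hW₀z : W₀ 0 = 0)
    (hW₀s : ∀ n : ℕ, W₀ (n + 1) =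
      maxUpTo θ (2 * (b ^ 2 + 1) *
        (max (2 * k + 1)
          (8 * b * (8 * k₀ ^ 2 + 16 * k₀ + 10) *
            maxUpTo (fun m => g (K + m)) (W₀ n)) + 1) ^ 2)) :
    ∃ N : ℕ, N ≤ K + W₀ P₀ ∧
      ∀ i j : ℕ, N ≤ i → i ≤ N + g N → N ≤ j → j ≤ N + g N →
        ‖x i - x j‖ ≤ 1 / ((k : ℝ) + 1) ∧ ‖x i - T (x i)‖ ≤ 1 / ((k : ℝ) + 1) := by
  have hmem : ∀ n, x n ∈ C ∧ y n ∈ C := by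
    have hyC : ∀ n, x n ∈ C → y n ∈ C := fun n hn => by
      rw [hy]
      exact hCconv (hTmap _ hn) hn (hβmem n).1 (sub_nonneg.2 (hβmem n).2) (by ring)
    have hxC : ∀ n, x n ∈ C := fun n => by
      induction n with
      | zero => rwa [hx0]
      | succ n ih =>
        rw [hxs]
        exact hCconv (hTmap _ (hyC n ih)) ih (hα n).1 (sub_nonneg.2 (hα n).2) (by ring)
    exact fun n => ⟨hxC n, hyC n (hxC n)⟩
  have hxC n := (hmem n).1
  have hαβ n : 0 ≤ α n * β n := mul_nonneg (hα n).1 (hβmem n).1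
  have hstep : ∀ n, K ≤ n → ∀ p ∈ C, ‖x (n + 1) - p‖ ^ 2 ≤
      ‖x n - p‖ ^ 2 + 4 * b * ‖p - T p‖ - α n * β n / 2 * ‖x n - T (x n)‖ ^ 2 := by
    intro n hn p hp
    have hβn : β n ≤ 1 / (2 + √(2 * L ^ 2 + 4)) := by
      refine (hρ _ n (hK ▸ hn)).trans (one_div_le_one_div_of_le (by positivity) ?_)
      linarith [Nat.le_ceil (1 + √(2 * L ^ 2 + 4))]
    have h1 := half_le_one_sub_of_le_inv_s19 (hβmem n).1 hβn
    have h2 := ishikawa_step_norm_sq_le_s19 hb hLip hPC (hα n).1 (hA3 n) (hβmem n).2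
      (hxC n) (hmem n).2 hp (hy n)
    have h3 := mul_le_mul_of_nonneg_left h1
      (mul_nonneg (hαβ n) (sq_nonneg ‖x n - T (x n)‖))
    rw [hxs]
    linarith
  have hfejer : ∀ n, K ≤ n → ∀ p ∈ C, ∀ m : ℕ,
      ‖x (n + m) - p‖ ^ 2 ≤ ‖x n - p‖ ^ 2 + m * (4 * b * ‖p - T p‖) := by
    intro n hn p hp m
    induction m with
    | zero => simp
    | succ m ih =>
      have h1 := hstep (n + m) (by omega) p hp
      have h2 := mul_nonneg (hαβ (n + m)) (sq_nonneg ‖x (n + m) - T (x (n + m))‖)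
      rw [← add_assoc]
      push_cast
      linarith
  have hsum : ∀ n, ∑ i ∈ Finset.range n, α (i + K) * β (i + K) * ‖x (i + K) - T (x (i + K))‖ ^ 2
      ≤ 2 * (b : ℝ) ^ 2 := by
    obtain ⟨q, hq, hTq⟩ := hFix
    intro n
    have h1 : ∑ i ∈ Finset.range n, α (i + K) * β (i + K) * ‖x (i + K) - T (x (i + K))‖ ^ 2
        ≤ 2 * (‖x K - q‖ ^ 2 - ‖x (n + K) - q‖ ^ 2) := by
      induction n with
      | zero => simp
      | succ n ih =>
        have h2 := hstep (n + K) (by omega) q hq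
        rw [hTq, sub_self, norm_zero] at h2
        rw [Finset.sum_range_succ, show n + 1 + K = n + K + 1 by omega]
        linarith
    have h3 := pow_le_pow_left₀ (norm_nonneg _) (hb _ (hxC K) q hq) 2
    linarith [sq_nonneg ‖x (n + K) - q‖]
  set h : ℕ → ℕ := fun m => g (K + m) with hh
  set χ : ℕ → ℕ := fun n => max (2 * k + 1)
    (8 * b * (8 * k₀ ^ 2 + 16 * k₀ + 10) * maxUpTo h (W₀ n)) with hχ
  have hWmono : Monotone W₀ := by
    refine monotone_nat_of_le_succ fun n => ?_
    induction n with
    | zero => simp [hW₀z]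
    | succ n ih =>
      rw [hW₀s n, hW₀s (n + 1)]
      refine maxUpTo_mono θ ?_
      have := maxUpTo_mono h ih
      gcongr
  have happrox : ∀ i, ∃ n ≤ W₀ i, ∀ i', i = i' + 1 →
      ‖x (n + K) - T (x (n + K))‖ ≤ 1 / ((χ i' : ℝ) + 1) := by
    rintro (_ | i)
    · exact ⟨0, Nat.zero_le _, fun i' hi' => by omega⟩
    · obtain ⟨n, hn, hn'⟩ := exists_le_inv_of_weighted_sum_le (r := χ i)
        (fun n => hαβ (n + K)) hθ hsum
      refine ⟨n, hn.trans ?_, fun i' hi' => ?_⟩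
      · rw [hW₀s]
        exact le_maxUpTo θ le_rfl
      · obtain rfl : i = i' := by omega
        exact hn'
  choose s hs hsT using happrox
  obtain ⟨i, j, hij, hj, hclose⟩ :=
    hγ ⌈√(8 * (k₀ : ℝ) ^ 2 + 16 * k₀ + 9)⌉₊ (fun i => x (s i + K)) (fun i => hxC _)
  rw [← hP₀] at hj
  obtain ⟨j, rfl⟩ : ∃ j', j = j' + 1 := ⟨j - 1, by omega⟩
  have hp := hsT (j + 1) j rfl
  set p := x (s (j + 1) + K) with hpdef
  have hpC : p ∈ C := hxC _
  have hdist : ∀ l, K + s i ≤ l → l ≤ K + s i + g (K + s i) →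
      ‖x l - p‖ ≤ 1 / (2 * ((k₀ : ℝ) + 1)) := by
    intro l hl hl'
    obtain ⟨m, rfl⟩ := Nat.exists_eq_add_of_le hl
    have hm : m ≤ maxUpTo h (W₀ j) :=
      (show m ≤ h (s i) by simp only [hh]; omega).trans
        (le_maxUpTo h ((hs i).trans (hWmono (by omega))))
    have h1 := hfejer (K + s i) (by omega) p hpC m
    set R : ℝ := 8 * (k₀ : ℝ) ^ 2 + 16 * k₀ + 10 with hR
    have hR0 : 0 < R := by positivity
    have h2 : ‖x (K + s i) - p‖ ^ 2 ≤ 1 / R := by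
      set S := √(8 * (k₀ : ℝ) ^ 2 + 16 * k₀ + 9) with hS
      have hS2 : S ^ 2 = 8 * (k₀ : ℝ) ^ 2 + 16 * k₀ + 9 := Real.sq_sqrt (by positivity)
      have hS0 : 0 ≤ S := Real.sqrt_nonneg _
      have h3 : ‖x (K + s i) - p‖ ≤ 1 / (S + 1) := by
        rw [add_comm K]
        exact hclose.trans (one_div_le_one_div_of_le (by positivity)
          (by linarith [Nat.le_ceil S]))
      calc ‖x (K + s i) - p‖ ^ 2 ≤ (1 / (S + 1)) ^ 2 := by gcongr
        _ = 1 / (S + 1) ^ 2 := by rw [div_pow, one_pow]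
        _ ≤ 1 / R := one_div_le_one_div_of_le hR0 (by nlinarith)
    have h3 : m * (4 * b * ‖p - T p‖) ≤ 1 / R := by
      have h4 : 8 * b * R * m ≤ χ j := by
        have : 8 * b * (8 * k₀ ^ 2 + 16 * k₀ + 10) * m ≤ χ j :=
          (Nat.mul_le_mul_left _ hm).trans (le_max_right _ _)
        rw [hR]
        exact_mod_cast this
      have h5 : ‖p - T p‖ * ((χ j : ℝ) + 1) ≤ 1 := (le_div_iff₀ (by positivity)).1 hp
      have h6 := mul_le_mul_of_nonneg_left h4 (norm_nonneg (p - T p))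
      have h7 : 0 ≤ m * (4 * b * ‖p - T p‖) * R := by positivity
      rw [le_div_iff₀ hR0]
      linarith [norm_nonneg (p - T p)]
    refine le_of_sq_le_sq ?_ (by positivity)
    calc ‖x (K + s i + m) - p‖ ^ 2 ≤ 1 / R + 1 / R := by linarith
      _ = 2 / R := by ring
      _ ≤ (1 / (2 * ((k₀ : ℝ) + 1))) ^ 2 := by
        rw [div_pow, div_le_div_iff₀ hR0 (by positivity), hR]
        linarith
  have hceil : 1 ≤ ⌈L⌉₊ := Nat.one_le_ceil_iff.2 hL
  have hk₀' : ((⌈L⌉₊ : ℝ) * (4 * k + 4) - 1) / 2 ≤ k₀ := hk₀ ▸ Nat.le_ceil _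
  have hceil' : (1 : ℝ) ≤ ⌈L⌉₊ := by exact_mod_cast hceil
  have hLceil := Nat.le_ceil L
  have hk0 : (0 : ℝ) ≤ k := Nat.cast_nonneg k
  have hbig : (⌈L⌉₊ : ℝ) * (4 * k + 4) ≤ 2 * ((k₀ : ℝ) + 1) := by linarith
  refine ⟨K + s i, Nat.add_le_add_left ((hs i).trans (hWmono (by omega))) K,
    fun l l' h1 h2 h3 h4 => ⟨?_, ?_⟩⟩
  · have h5 : 1 / (2 * ((k₀ : ℝ) + 1)) ≤ 1 / (2 * ((k : ℝ) + 1)) :=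
      one_div_le_one_div_of_le (by positivity) (by nlinarith)
    have h6 : 1 / (2 * ((k : ℝ) + 1)) + 1 / (2 * ((k : ℝ) + 1)) = 1 / ((k : ℝ) + 1) := by
      field_simp; norm_num
    have h7 := norm_sub_le_norm_sub_add_norm_sub (x l) p (x l')
    rw [norm_sub_rev p] at h7
    linarith [hdist l h1 h2, hdist l' h3 h4]
  · have h5 : ‖p - T p‖ ≤ 1 / (2 * ((k : ℝ) + 1)) := by
      refine hp.trans (one_div_le_one_div_of_le (by positivity) ?_)
      have : 2 * k + 1 ≤ χ j := le_max_left _ _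
      have : (2 * k + 1 : ℝ) ≤ χ j := by exact_mod_cast this
      linarith
    have h6 : (1 + L) * ‖x l - p‖ ≤ 1 / (2 * ((k : ℝ) + 1)) := by
      have h7 : ‖x l - p‖ * (2 * ((k₀ : ℝ) + 1)) ≤ 1 :=
        (le_div_iff₀ (by positivity)).1 (hdist l h1 h2)
      have h8 : (1 + L) * (2 * ((k : ℝ) + 1)) ≤ 2 * ((k₀ : ℝ) + 1) := by nlinarith
      rw [le_div_iff₀ (by positivity)]
      linarith [mul_le_mul_of_nonneg_left h8 (norm_nonneg (x l - p))]
    have h7 : ‖x l - T (x l)‖ ≤ ‖x l - p‖ + ‖p - T p‖ + ‖T p - T (x l)‖ := by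
      rw [show x l - T (x l) = (x l - p) + (p - T p) + (T p - T (x l)) by abel]
      exact norm_add₃_le
    have h8 := hLip p hpC (x l) (hxC l)
    rw [norm_sub_rev p] at h8
    have h9 : 1 / (2 * ((k : ℝ) + 1)) + 1 / (2 * ((k : ℝ) + 1)) = 1 / ((k : ℝ) + 1) := by
      field_simp; norm_num
    linarith
end
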